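/- Let F = ℚ(x, y) be the field of rational functions in two variables x, y over ℚ, and let (a_n)_{n≥1} be the sequence in F defined by a₁ = x, a₂ = y, and a_{n+1} = (a_n² + 1)/a_{n−1} for n ≥ 2. Then for every n ≥ 1 there exist a polynomial p ∈ ℤ[x, y] all of whose coefficients are nonnegative and natural numbers k, l such that a_n = p(x, y)/(x^k · y^l); that is, every a_n is a Laurent polynomial in x and y with nonnegative integer coefficients. -/

import Mathlib

open MvPolynomial in
/-- `z` is a Laurent polynomial in `x` and `y` with nonnegative integer coefficients. -/
def IsPositiveLaurent {K : Type*} [Field K] [Algebra ℤ K] (x y z : K) : Prop :=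
  ∃ (p : MvPolynomial (Fin 2) ℤ) (k l : ℕ),
    (∀ m, 0 ≤ coeff m p) ∧ z = aeval ![x, y] p / (x ^ k * y ^ l)

namespace MvPolynomial

theorem coeff_monomial_nonneg {σ R : Type*} [CommSemiring R] [Preorder R] (s : σ →₀ ℕ)
    {r : R} (hr : 0 ≤ r) (m : σ →₀ ℕ) : 0 ≤ coeff m (monomial s r) := by
  classical
  rw [coeff_monomial]
  split_ifs <;> simp [hr]

variable {σ R : Type*} [CommRing R] [PartialOrder R] [IsOrderedRing R]

theorem coeff_add_nonneg {p q : MvPolynomial σ R} (hp : ∀ m, 0 ≤ coeff m p)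
    (hq : ∀ m, 0 ≤ coeff m q) (m : σ →₀ ℕ) : 0 ≤ coeff m (p + q) := by
  rw [coeff_add]
  exact add_nonneg (hp m) (hq m)

theorem coeff_mul_nonneg {p q : MvPolynomial σ R} (hp : ∀ m, 0 ≤ coeff m p)
    (hq : ∀ m, 0 ≤ coeff m q) (m : σ →₀ ℕ) : 0 ≤ coeff m (p * q) := by
  classical
  rw [coeff_mul]
  exact Finset.sum_nonneg fun i _ => mul_nonneg (hp i.1) (hq i.2)

end MvPolynomial

namespace IsPositiveLaurent

open MvPolynomial

variable {K : Type*} [Field K] [Algebra ℤ K] {x y z w : K}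

theorem mul (hz : IsPositiveLaurent x y z) (hw : IsPositiveLaurent x y w) :
    IsPositiveLaurent x y (z * w) := by
  obtain ⟨p, k, l, hp, rfl⟩ := hz
  obtain ⟨q, k', l', hq, rfl⟩ := hw
  refine ⟨p * q, k + k', l + l', coeff_mul_nonneg hp hq, ?_⟩
  rw [map_mul, div_mul_div_comm]
  ring

theorem aeval_monomial_pair (x y : K) (i j : ℕ) :
    aeval ![x, y] (monomial (Finsupp.single 0 i + Finsupp.single 1 j) (1 : ℤ)) =
      x ^ i * y ^ j := by
  rw [← one_mul (1 : ℤ), ← monomial_mul, map_mul, ← X_pow_eq_monomial, ← X_pow_eq_monomial]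
  simp

theorem monomial_div (i j k l : ℕ) :
    IsPositiveLaurent x y (x ^ i * y ^ j / (x ^ k * y ^ l)) := by
  refine ⟨monomial (Finsupp.single 0 i + Finsupp.single 1 j) 1, k, l,
    coeff_monomial_nonneg _ zero_le_one, ?_⟩
  rw [aeval_monomial_pair]

theorem zero : IsPositiveLaurent x y 0 := ⟨0, 0, 0, by simp, by simp⟩

theorem add (hx : x ≠ 0) (hy : y ≠ 0) (hz : IsPositiveLaurent x y z)
    (hw : IsPositiveLaurent x y w) : IsPositiveLaurent x y (z + w) := by
  obtain ⟨p, k, l, hp, rfl⟩ := hz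
  obtain ⟨q, k', l', hq, rfl⟩ := hw
  refine ⟨p * monomial (Finsupp.single 0 k' + Finsupp.single 1 l') 1 +
    q * monomial (Finsupp.single 0 k + Finsupp.single 1 l) 1, k + k', l + l',
    coeff_add_nonneg (coeff_mul_nonneg hp (coeff_monomial_nonneg _ zero_le_one))
      (coeff_mul_nonneg hq (coeff_monomial_nonneg _ zero_le_one)), ?_⟩
  rw [map_add, map_mul, map_mul, aeval_monomial_pair, aeval_monomial_pair]
  rw [div_add_div _ _ (mul_ne_zero (pow_ne_zero k hx) (pow_ne_zero l hy))
    (mul_ne_zero (pow_ne_zero k' hx) (pow_ne_zero l' hy))]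
  ring

end IsPositiveLaurent

/-- In the field of fractions of a polynomial ring over `ℚ`, `-1` is not a square. -/
theorem MvPolynomial.sq_add_one_ne_zero_of_fractionRing {σ : Type*}
    (z : FractionRing (MvPolynomial σ ℚ)) : z ^ 2 + 1 ≠ 0 := by
  intro h
  obtain ⟨p, q, hq, rfl⟩ := IsFractionRing.div_surjective (A := MvPolynomial σ ℚ) z
  have hq0 : q ≠ 0 := nonZeroDivisors.ne_zero hq
  have hq1 : algebraMap (MvPolynomial σ ℚ) (FractionRing (MvPolynomial σ ℚ)) q ≠ 0 := by
    simpa using hq0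
  have hpq : p ^ 2 + q ^ 2 = 0 := by
    apply IsFractionRing.injective (MvPolynomial σ ℚ) (FractionRing (MvPolynomial σ ℚ))
    field_simp at h
    simpa using h
  refine hq0 (MvPolynomial.funext fun v => ?_)
  have hv := congrArg (eval v) hpq
  simp only [map_add, map_pow, map_zero] at hv ⊢
  nlinarith [sq_nonneg (eval v p), sq_nonneg (eval v q)]

/-- The sequence satisfies the linear recurrence `aₙ₊₂ = T aₙ₊₁ - aₙ` with
`T = y / x + x / y + 1 / (x y)`. Written for the pair `aₙ`, `aₙ₊₁ - (y / x) aₙ` it is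
subtraction-free. -/
theorem isPositiveLaurent_of_exchange {K : Type*} [Field K] [Algebra ℤ K] {x y : K}
    (hx : x ≠ 0) (hy : y ≠ 0) (hsq : ∀ z : K, z ^ 2 + 1 ≠ 0) {a : ℕ → K}
    (ha1 : a 1 = x) (ha2 : a 2 = y)
    (harec : ∀ n, 2 ≤ n → a (n + 1) = (a n ^ 2 + 1) / a (n - 1)) {n : ℕ} (hn : 1 ≤ n) :
    IsPositiveLaurent x y (a n) := by
  suffices h : a n ≠ 0 ∧ a (n + 1) ≠ 0 ∧
      x * y * (a (n + 1) ^ 2 + a n ^ 2 + 1) = (x ^ 2 + y ^ 2 + 1) * (a n * a (n + 1)) ∧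
      IsPositiveLaurent x y (a n) ∧ IsPositiveLaurent x y (a (n + 1) - y / x * a n) from h.2.2.2.1
  induction n, hn using Nat.le_induction with
  | base =>
    refine ⟨by rwa [ha1], by rwa [ha2], by rw [ha1, ha2]; ring, ?_, ?_⟩
    · simpa [ha1] using IsPositiveLaurent.monomial_div (x := x) (y := y) 1 0 0 0
    · rw [ha1, ha2, div_mul_cancel₀ _ hx, sub_self]
      exact IsPositiveLaurent.zero
  | succ n hn ih =>
    obtain ⟨h0, h1, hinv, hpos, hdiff⟩ := ih
    have hrec : a (n + 2) = (a (n + 1) ^ 2 + 1) / a n := harec (n + 1) (by lia)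
    have hmul : a (n + 2) * a n = a (n + 1) ^ 2 + 1 := by rw [hrec, div_mul_cancel₀ _ h0]
    have hlin : x * y * (a (n + 2) + a n) = (x ^ 2 + y ^ 2 + 1) * a (n + 1) := by
      apply mul_right_cancel₀ h0
      linear_combination hinv + x * y * hmul
    refine ⟨h1, ?_, ?_, ?_, ?_⟩
    · rw [hrec]
      exact div_ne_zero (hsq _) h0
    · linear_combination a (n + 2) * hlin - x * y * hmul
    · convert hdiff.add hx hy ((IsPositiveLaurent.monomial_div 0 1 1 0).mul hpos) using 1
      simp
    · convert (((IsPositiveLaurent.monomial_div 2 0 1 1).add hx hy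
        (IsPositiveLaurent.monomial_div 0 0 1 1)).mul hdiff).add hx hy
        ((IsPositiveLaurent.monomial_div 0 0 2 0).mul hpos) using 1
      field_simp
      linear_combination x * hlin

/-- Positivity of the Laurent phenomenon for the rank 2 cluster algebra 𝒜(2,2): every
term of the sequence a₁ = x, a₂ = y, a_{n+1} = (aₙ² + 1)/a_{n−1} in ℚ(x,y) is a Laurent
polynomial in x and y with nonnegative integer coefficients. -/
theorem laurent_positivity_A22
    (x y : FractionRing (MvPolynomial (Fin 2) ℚ))
    (hx : x = algebraMap (MvPolynomial (Fin 2) ℚ)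
      (FractionRing (MvPolynomial (Fin 2) ℚ)) (MvPolynomial.X 0))
    (hy : y = algebraMap (MvPolynomial (Fin 2) ℚ)
      (FractionRing (MvPolynomial (Fin 2) ℚ)) (MvPolynomial.X 1))
    (a : ℕ → FractionRing (MvPolynomial (Fin 2) ℚ))
    (ha1 : a 1 = x) (ha2 : a 2 = y)
    (harec : ∀ n, 2 ≤ n → a (n + 1) = (a n ^ 2 + 1) / a (n - 1)) :
    ∀ n, 1 ≤ n → ∃ (p : MvPolynomial (Fin 2) ℤ) (k l : ℕ),
      (∀ m, 0 ≤ MvPolynomial.coeff m p) ∧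
      a n = MvPolynomial.aeval ![x, y] p / (x ^ k * y ^ l) := by
  subst hx hy
  intro n hn
  exact isPositiveLaurent_of_exchange (by simp) (by simp)
    MvPolynomial.sq_add_one_ne_zero_of_fractionRing ha1 ha2 harec hn
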